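/- arXiv:2309.06427 — 2 statements merged into one kernel-verified Lean document; each statement's English description precedes it below -/
import Mathlib

section
/- Let S be a symmetric block tridiagonal matrix all of whose diagonal blocks are invertible. If v ≠ 0 is a vector supported on blocks of odd index (v = v_e) with Ψl⁻¹ * Pl *ᵥ v = 0, then Φadd⁻¹ * S *ᵥ v = v; that is, (1, v) is an eigenpair of Φadd⁻¹ * S. -/
open Matrix

namespace StairPrecond

/-- Real matrices indexed as n×n arrays of m×m blocks. -/
abbrev Mat (n m : ℕ) := Matrix (Fin n × Fin m) (Fin n × Fin m) ℝ

/-- Vectors compatible with `Mat n m`. -/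
abbrev Vec (n m : ℕ) := Fin n × Fin m → ℝ

/-- The (i,j)-block of a block matrix. -/
def blockOf {n m : ℕ} (M : Mat n m) (i j : Fin n) : Matrix (Fin m) (Fin m) ℝ :=
  fun a b => M (i, a) (j, b)

/-- A matrix is block tridiagonal if its (i,j)-block vanishes whenever |i - j| > 1. -/
def IsBlockTridiag {n m : ℕ} (M : Mat n m) : Prop :=
  ∀ i j : Fin n, (i.val + 1 < j.val ∨ j.val + 1 < i.val) → blockOf M i j = 0

/-- The block-diagonal part `D` of a matrix: keep only the diagonal blocks. -/
def blockDiagPart {n m : ℕ} (M : Mat n m) : Mat n m :=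
  fun p q => if p.1 = q.1 then M p q else 0

/-- The left stair Ψl: diagonal blocks everywhere, off-diagonal blocks only in
block rows of odd index (0-indexed). -/
def stairL {n m : ℕ} (M : Mat n m) : Mat n m :=
  fun p q =>
    if p.1 = q.1 ∨ (Odd p.1.val ∧ (p.1.val = q.1.val + 1 ∨ q.1.val = p.1.val + 1)) then M p q
    else 0

/-- The right stair Ψr: diagonal blocks everywhere, off-diagonal blocks only in
block rows of even index (0-indexed). -/
def stairR {n m : ℕ} (M : Mat n m) : Mat n m :=
  fun p q =>
    if p.1 = q.1 ∨ (Even p.1.val ∧ (p.1.val = q.1.val + 1 ∨ q.1.val = p.1.val + 1)) then M p q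
    else 0

/-- Pl = Ψl − S. -/
def Pl {n m : ℕ} (S : Mat n m) : Mat n m := stairL S - S

/-- Pr = Ψr − S. -/
def Pr {n m : ℕ} (S : Mat n m) : Mat n m := stairR S - S

/-- The additive stair preconditioner Φadd⁻¹ = (1/2) • (Ψl⁻¹ + Ψr⁻¹). -/
noncomputable def Phiadd {n m : ℕ} (S : Mat n m) : Mat n m :=
  (1 / 2 : ℝ) • ((stairL S)⁻¹ + (stairR S)⁻¹)

/-- The symmetric stair preconditioner Φsym⁻¹ = Ψl⁻¹ + Ψr⁻¹ − D⁻¹. -/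
noncomputable def Phisym {n m : ℕ} (S : Mat n m) : Mat n m :=
  (stairL S)⁻¹ + (stairR S)⁻¹ - (blockDiagPart S)⁻¹

/-- All diagonal blocks are invertible m×m matrices. -/
def DiagBlocksInvertible {n m : ℕ} (M : Mat n m) : Prop :=
  ∀ i : Fin n, IsUnit (blockOf M i i)

/-- v_e : the part of v supported on blocks of odd index (0-indexed). -/
def vE {n m : ℕ} (v : Vec n m) : Vec n m := fun p => if Odd p.1.val then v p else 0

/-- v_o : the part of v supported on blocks of even index (0-indexed). -/
def vO {n m : ℕ} (v : Vec n m) : Vec n m := fun p => if Even p.1.val then v p else 0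

/-- A stair matrix: block tridiagonal, with off-diagonal blocks nonzero only in
block rows of a fixed parity (a left stair has them only in odd-indexed rows,
a right stair only in even-indexed rows, 0-indexed). -/
def IsStairMatrix {n m : ℕ} (Ψ : Mat n m) : Prop :=
  IsBlockTridiag Ψ ∧
    ((∀ i j : Fin n, i ≠ j → Even i.val → blockOf Ψ i j = 0) ∨
     (∀ i j : Fin n, i ≠ j → Odd i.val → blockOf Ψ i j = 0))

/-- A block matrix with invertible diagonal blocks is invertible if its off-diagonal blocks vanish
except in block rows satisfying `P` and block columns not satisfying `P`. -/
theorem isUnit_of_diag_blocks {n m : ℕ} (M : Mat n m) (P : Fin n → Prop)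
    (hM : ∀ p q : Fin n × Fin m, p.1 ≠ q.1 → ¬(P p.1 ∧ ¬P q.1) → M p q = 0)
    (hD : DiagBlocksInvertible M) : IsUnit M := by
  rw [← Matrix.mulVec_injective_iff_isUnit]
  refine (injective_iff_map_eq_zero M.mulVecLin).2 fun x hx => ?_
  have key : ∀ i, (∀ p q : Fin n × Fin m, p.1 = i → p.1 ≠ q.1 → M p q * x q = 0) →
      ∀ a, x (i, a) = 0 := by
    intro i hi
    have hblock : blockOf M i i *ᵥ (fun a => x (i, a)) = 0 := by
      ext a
      have hrow : ∑ q, M (i, a) q * x q = 0 := congrFun hx (i, a)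
      rw [Fintype.sum_prod_type, Finset.sum_eq_single i] at hrow
      · exact hrow
      · exact fun j _ hj => Finset.sum_eq_zero fun b _ => hi (i, a) (j, b) rfl hj.symm
      · simp
    exact congrFun <|
      Matrix.mulVec_injective_of_isUnit (hD i) (hblock.trans (Matrix.mulVec_zero _).symm)
  have hnot : ∀ i, ¬P i → ∀ a, x (i, a) = 0 := fun i hi =>
    key i fun p q hp hpq => by rw [hM p q hpq fun h => hi (hp ▸ h.1), zero_mul]
  funext ⟨i, a⟩
  by_cases hi : P i
  · refine key i (fun p q hp hpq => ?_) a
    by_cases hq : P q.1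
    · rw [hM p q hpq fun h => h.2 hq, zero_mul]
    · rw [hnot q.1 hq q.2, mul_zero]
  · exact hnot i hi a

theorem isUnit_stairL {n m : ℕ} {S : Mat n m} (hdiag : DiagBlocksInvertible S) :
    IsUnit (stairL S) := by
  refine isUnit_of_diag_blocks _ (fun i => Odd i.val) (fun p q hpq h => ?_) fun i => ?_
  · refine if_neg ?_
    rintro (h1 | ⟨h1, h2⟩)
    · exact hpq h1
    · exact h ⟨h1, by grind⟩
  · convert hdiag i using 1
    ext a b
    simp [blockOf, stairL]

theorem isUnit_stairR {n m : ℕ} {S : Mat n m} (hdiag : DiagBlocksInvertible S) :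
    IsUnit (stairR S) := by
  refine isUnit_of_diag_blocks _ (fun i => Even i.val) (fun p q hpq h => ?_) fun i => ?_
  · refine if_neg ?_
    rintro (h1 | ⟨h1, h2⟩)
    · exact hpq h1
    · exact h ⟨h1, by grind⟩
  · convert hdiag i using 1
    ext a b
    simp [blockOf, stairR]

/-- On vectors supported on blocks of odd index, `S` agrees with its right stair. -/
theorem mulVec_eq_stairR_mulVec {n m : ℕ} {S : Mat n m} (htri : IsBlockTridiag S) {v : Vec n m}
    (hsupp : ∀ p : Fin n × Fin m, Even p.1.val → v p = 0) : S *ᵥ v = stairR S *ᵥ v := by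
  ext p
  refine Finset.sum_congr rfl fun q _ => ?_
  by_cases hq : Even q.1.val
  · rw [hsupp q hq, mul_zero, mul_zero]
  · congr 1
    simp only [stairR]
    split_ifs with h
    · rfl
    · refine congrFun (congrFun (htri p.1 q.1 ?_) p.2) q.2
      have : p.1.val ≠ q.1.val := fun h' => h (Or.inl (Fin.ext h'))
      grind

/-- If v ≠ 0 is supported on blocks of odd index and Ψl⁻¹ * Pl *ᵥ v = 0, then
(1, v) is an eigenpair of Φadd⁻¹ * S. -/
theorem add_eigenpair_one_of_left_kernel {n m : ℕ} (hn : 0 < n) (hm : 0 < m)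
    (S : Mat n m) (hsymm : S.IsSymm) (htri : IsBlockTridiag S)
    (hdiag : DiagBlocksInvertible S)
    (v : Vec n m) (hv : v ≠ 0)
    (hsupp : ∀ p : Fin n × Fin m, Even p.1.val → v p = 0)
    (hker : ((stairL S)⁻¹ * Pl S) *ᵥ v = 0) :
    (Phiadd S * S) *ᵥ v = v := by
  have hL := (Matrix.isUnit_iff_isUnit_det _).1 (isUnit_stairL hdiag)
  have hR := (Matrix.isUnit_iff_isUnit_det _).1 (isUnit_stairR hdiag)
  have hleft : (stairL S)⁻¹ *ᵥ (S *ᵥ v) = v := by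
    rw [Pl, Matrix.mul_sub, Matrix.nonsing_inv_mul _ hL, Matrix.sub_mulVec, Matrix.one_mulVec,
      sub_eq_zero, ← Matrix.mulVec_mulVec] at hker
    exact hker.symm
  have hright : (stairR S)⁻¹ *ᵥ (S *ᵥ v) = v := by
    rw [mulVec_eq_stairR_mulVec htri hsupp, Matrix.mulVec_mulVec, Matrix.nonsing_inv_mul _ hR,
      Matrix.one_mulVec]
  rw [← Matrix.mulVec_mulVec, Phiadd, Matrix.smul_mulVec, Matrix.add_mulVec, hleft, hright,
    ← two_smul ℝ v, smul_smul]
  norm_num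

end StairPrecond
end

section
/- If S is a symmetric block tridiagonal matrix that is positive definite, then the stairs satisfy Ψl + Ψr = S + D, Ψr = Ψlᵀ, and the quadratic form of each stair is positive: xᵀ Ψl x > 0 and xᵀ Ψr x > 0 for every nonzero vector x; in particular Ψl and Ψr are invertible. -/
open Matrix

namespace StairPrecond

theorem IsBlockTridiag.apply_eq_zero {n m : ℕ} {M : Mat n m} (h : IsBlockTridiag M)
    {p q : Fin n × Fin m} (hpq : p.1.val + 1 < q.1.val ∨ q.1.val + 1 < p.1.val) : M p q = 0 :=
  congrFun (congrFun (h p.1 q.1 hpq) p.2) q.2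

theorem stairL_add_stairR {n m : ℕ} {S : Mat n m} (htri : IsBlockTridiag S) :
    stairL S + stairR S = S + blockDiagPart S := by
  ext p q
  have h := htri.apply_eq_zero (p := p) (q := q)
  simp only [Matrix.add_apply, stairL, stairR, blockDiagPart, Fin.ext_iff]
  grind

theorem stairR_eq_transpose_stairL {n m : ℕ} {S : Mat n m} (hS : S.IsSymm) :
    stairR S = (stairL S)ᵀ := by
  ext p q
  have h := hS.apply p q
  simp only [Matrix.transpose_apply, stairL, stairR, Fin.ext_iff]
  grind

/-- The quadratic form of the block-diagonal part is the sum of the quadratic forms of the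
matrix at the restrictions of the vector to the blocks. -/
theorem dotProduct_blockDiagPart_mulVec {n m : ℕ} (M : Mat n m) (x : Vec n m) :
    x ⬝ᵥ (blockDiagPart M *ᵥ x) =
      ∑ i, (fun p => if p.1 = i then x p else 0) ⬝ᵥ
        (M *ᵥ fun p => if p.1 = i then x p else 0) := by
  simp only [dotProduct, mulVec, blockDiagPart, Finset.mul_sum]
  symm
  rw [Finset.sum_comm]
  refine Finset.sum_congr rfl fun p _ => ?_
  rw [Finset.sum_comm]
  refine Finset.sum_congr rfl fun q _ => ?_
  rw [Finset.sum_eq_single p.1 (by simp +contextual [eq_comm]) (by simp)]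
  simp [eq_comm]

theorem dotProduct_blockDiagPart_mulVec_nonneg {n m : ℕ} {S : Mat n m} (hS : S.PosSemidef)
    (x : Vec n m) : 0 ≤ x ⬝ᵥ (blockDiagPart S *ᵥ x) := by
  rw [dotProduct_blockDiagPart_mulVec]
  exact Finset.sum_nonneg fun i _ => by simpa using hS.dotProduct_mulVec_nonneg _

theorem dotProduct_transpose_mulVec_self {ι : Type*} [Fintype ι] (A : Matrix ι ι ℝ)
    (x : ι → ℝ) : x ⬝ᵥ (Aᵀ *ᵥ x) = x ⬝ᵥ (A *ᵥ x) := by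
  rw [mulVec_transpose, dotProduct_comm, dotProduct_mulVec]

theorem isUnit_of_dotProduct_mulVec_pos {ι : Type*} [Fintype ι] [DecidableEq ι]
    {A : Matrix ι ι ℝ} (hA : ∀ x : ι → ℝ, x ≠ 0 → 0 < x ⬝ᵥ (A *ᵥ x)) : IsUnit A := by
  rw [← mulVec_injective_iff_isUnit]
  refine (injective_iff_map_eq_zero A.mulVecLin).2 fun x hx => ?_
  by_contra h
  have hpos := hA x h
  rw [← mulVecLin_apply, hx, dotProduct_zero] at hpos
  exact hpos.false

/-- The stairs of a symmetric block tridiagonal positive definite matrix satisfy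
Ψl + Ψr = S + D, Ψr = Ψlᵀ, have positive quadratic forms, and are invertible. -/
theorem stairs_posdef_properties {n m : ℕ} (hn : 0 < n) (hm : 0 < m)
    (S : Mat n m) (htri : IsBlockTridiag S) (hpd : S.PosDef) :
    stairL S + stairR S = S + blockDiagPart S ∧
      stairR S = (stairL S)ᵀ ∧
      (∀ x : Vec n m, x ≠ 0 → 0 < x ⬝ᵥ (stairL S *ᵥ x)) ∧
      (∀ x : Vec n m, x ≠ 0 → 0 < x ⬝ᵥ (stairR S *ᵥ x)) ∧
      IsUnit (stairL S) ∧ IsUnit (stairR S) := by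
  have hadd := stairL_add_stairR htri
  have htr : stairR S = (stairL S)ᵀ :=
    stairR_eq_transpose_stairL (by simpa [IsHermitian, IsSymm] using hpd.isHermitian)
  have hl : ∀ x : Vec n m, x ≠ 0 → 0 < x ⬝ᵥ (stairL S *ᵥ x) := by
    intro x hx
    have hsum := congrArg (fun M => x ⬝ᵥ (M *ᵥ x)) hadd
    simp only [htr, add_mulVec, dotProduct_add, dotProduct_transpose_mulVec_self] at hsum
    have hS : 0 < x ⬝ᵥ (S *ᵥ x) := by simpa using hpd.dotProduct_mulVec_pos hx
    have hD := dotProduct_blockDiagPart_mulVec_nonneg hpd.posSemidef x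
    linarith
  have hr : ∀ x : Vec n m, x ≠ 0 → 0 < x ⬝ᵥ (stairR S *ᵥ x) := by
    intro x hx
    rw [htr, dotProduct_transpose_mulVec_self]
    exact hl x hx
  exact ⟨hadd, htr, hl, hr, isUnit_of_dotProduct_mulVec_pos hl,
    isUnit_of_dotProduct_mulVec_pos hr⟩

end StairPrecond
end
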